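/- Let α : ℝ → ℝ be C¹ with sup_{[−1/2,1/2]} |α′| ≤ 1, set γ(r) := (0, α(r), r), let ε ∈ (0,1], Γ > 0, r₀ ∈ [−1/2,1/2], and let w : ℝ → ℝ be C² with bounded second derivative. Define v₂(y) := −Γ ∫_{−1/2}^{1/2} k̄₁^ε(y − γ(r)) dr for y ∈ ℝ³. Then there is a universal constant C such that |∫_{[−1/2,1/2]³} k̄₁^ε(γ(r₀) − y) v₂(y) (w′(y₂) − w′(α(r₀))) dy| ≤ C Γ ‖w″‖_{L^∞}, uniformly in ε. -/

import Mathlib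

open MeasureTheory Real

noncomputable section

/-- The vector `(a,b,c) ∈ ℝ³`. -/
def v3 (a b c : ℝ) : EuclideanSpace ℝ (Fin 3) :=
  (WithLp.equiv 2 (Fin 3 → ℝ)).symm ![a, b, c]

/-- The filament curve `γ(r) = (0, α(r), r)`. -/
def gam (α : ℝ → ℝ) (r : ℝ) : EuclideanSpace ℝ (Fin 3) := v3 0 (α r) r

/-- First component of the regularized Biot–Savart kernel:
`k̄₁^ε(x) = x₁/(4π(|x|²+ε²)^{3/2})`. -/
def k1eps (ε : ℝ) (x : EuclideanSpace ℝ (Fin 3)) : ℝ :=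
  x 0 / (4 * π * (‖x‖ ^ 2 + ε ^ 2) ^ ((3 : ℝ) / 2))

/-- The fundamental cube `[−1/2,1/2]³`. -/
def cube3 : Set (EuclideanSpace ℝ (Fin 3)) :=
  {y | ∀ i, y i ∈ Set.Icc (-(1/2) : ℝ) (1/2)}

/-- One-dimensional majorant `(t² + ε²)^{-3/8}`. -/
def hh (ε t : ℝ) : ℝ := (t ^ 2 + ε ^ 2) ^ (-(3 / 8) : ℝ)

lemma hh_nonneg (ε t : ℝ) : 0 ≤ hh ε t := by
  unfold hh; positivity

lemma hh_meas (ε : ℝ) : Measurable (hh ε) := by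
  unfold hh; fun_prop

/-- One-sided singular majorant. -/
def GG (t : ℝ) : ENNReal :=
  (Set.Ioc (0 : ℝ) 1).indicator (fun t => ENNReal.ofReal (t ^ (-(3 / 4) : ℝ))) t

lemma GG_meas : Measurable GG := by
  unfold GG
  exact Measurable.indicator (by fun_prop) measurableSet_Ioc

lemma GG_lt_top : ∫⁻ t, GG t < ⊤ := by
  unfold GG
  rw [lintegral_indicator measurableSet_Ioc]
  have h : IntervalIntegrable (fun x : ℝ => x ^ (-(3 / 4) : ℝ)) volume 0 1 :=
    intervalIntegral.intervalIntegrable_rpow' (by norm_num)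
  rw [intervalIntegrable_iff_integrableOn_Ioc_of_le zero_le_one] at h
  exact h.lintegral_lt_top

lemma hh_le (ε t : ℝ) (ht : t ≠ 0) : ENNReal.ofReal (hh ε t) ≤ GG t + GG (-t) + 1 := by
  have hle : hh ε t ≤ |t| ^ (-(3 / 4) : ℝ) := by
    have h1 : |t| ^ (-(3 / 4) : ℝ) = (t ^ 2) ^ (-(3 / 8) : ℝ) := by
      rw [← sq_abs, ← Real.rpow_natCast, ← Real.rpow_mul (abs_nonneg _)]; norm_num
    rw [h1]
    unfold hh
    apply Real.rpow_le_rpow_of_nonpos (by positivity) (by nlinarith [sq_nonneg ε]) (by norm_num)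
  by_cases h1 : |t| ≤ 1
  · rcases lt_or_gt_of_ne ht with h | h
    · rw [abs_of_neg h] at hle h1
      have : ENNReal.ofReal (hh ε t) ≤ GG (-t) := by
        unfold GG
        rw [Set.indicator_of_mem (Set.mem_Ioc.2 ⟨by linarith, h1⟩)]
        exact ENNReal.ofReal_le_ofReal hle
      exact this.trans (by rw [add_comm (GG t), add_assoc]; exact le_self_add)
    · rw [abs_of_pos h] at hle h1
      have : ENNReal.ofReal (hh ε t) ≤ GG t := by
        unfold GG
        rw [Set.indicator_of_mem (Set.mem_Ioc.2 ⟨by linarith, h1⟩)]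
        exact ENNReal.ofReal_le_ofReal hle
      exact this.trans (by rw [add_assoc]; exact le_self_add)
  · push Not at h1
    have : hh ε t ≤ 1 := hle.trans (Real.rpow_le_one_of_one_le_of_nonpos h1.le (by norm_num))
    exact (ENNReal.ofReal_le_one.2 this).trans le_add_self

/-- The interval. -/
def II : Set ℝ := Set.Icc (-(1/2) : ℝ) (1/2)

/-- Universal constant. -/
def KK : ENNReal := 2 * (∫⁻ t, GG t) + 1

lemma KK_lt_top : KK < ⊤ := by
  unfold KK
  exact ENNReal.add_lt_top.2 ⟨ENNReal.mul_lt_top (by simp) GG_lt_top, by simp⟩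

lemma hh_int (ε c : ℝ) : ∫⁻ t in II, ENNReal.ofReal (hh ε (t - c)) ≤ KK := by
  have hm := GG_meas
  calc ∫⁻ t in II, ENNReal.ofReal (hh ε (t - c))
      ≤ ∫⁻ t in II, (GG (t - c) + GG (c - t) + 1) := by
        apply lintegral_mono_ae
        apply ae_restrict_of_ae
        have : ∀ᵐ t : ℝ, t ≠ c := by
          simp [ae_iff]
        filter_upwards [this] with t ht
        have := hh_le ε (t - c) (sub_ne_zero.2 ht)
        rwa [neg_sub] at this
    _ = (∫⁻ t in II, GG (t - c)) + (∫⁻ t in II, GG (c - t)) + ∫⁻ t in II, 1 := by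
        rw [lintegral_add_left (by fun_prop), lintegral_add_left (by fun_prop)]
    _ ≤ (∫⁻ t, GG (t - c)) + (∫⁻ t, GG (c - t)) + 1 := by
        gcongr
        · exact Measure.restrict_le_self
        · exact Measure.restrict_le_self
        · simp [II]; norm_num
    _ = KK := by
        rw [lintegral_sub_right_eq_self, lintegral_sub_left_eq_self, KK, two_mul]

/-- Pointwise algebraic bound. -/
lemma key {a b0 P Q u1 u2 u3 u4 : ℝ} (ha : 0 ≤ a) (hb : 0 ≤ b0) (hP : 0 < P) (hQ : 0 < Q)
    (h1 : 0 < u1) (h2 : 0 < u2) (h3 : 0 < u3) (h4 : 0 < u4)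
    (h1P : u1 ≤ 3 * P) (h2P : u2 ≤ 3 * P) (h3P : u3 ≤ 3 * P)
    (h1Q : u1 ≤ 3 * Q) (h2Q : u2 ≤ 3 * Q) (h4Q : u4 ≤ 3 * Q)
    (hab : a * b0 ≤ P) (haQ : a ^ 2 ≤ Q) :
    (a / (4 * π * P ^ ((3 : ℝ) / 2))) * (a / (4 * π * Q ^ ((3 : ℝ) / 2))) * b0 ≤
      u1 ^ (-(3 / 8) : ℝ) * u2 ^ (-(3 / 8) : ℝ) * u3 ^ (-(3 / 8) : ℝ) * u4 ^ (-(3 / 8) : ℝ) := by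
  obtain ⟨p, hp, rfl⟩ : ∃ p : ℝ, 0 < p ∧ P = p ^ 2 :=
    ⟨√P, by positivity, (Real.sq_sqrt hP.le).symm⟩
  obtain ⟨q, hq, rfl⟩ : ∃ p : ℝ, 0 < p ∧ Q = p ^ 2 :=
    ⟨√Q, by positivity, (Real.sq_sqrt hQ.le).symm⟩
  have e : ∀ x : ℝ, 0 < x → (x ^ 2) ^ ((3 : ℝ) / 2) = x ^ 3 := by
    intro x hx
    rw [← Real.rpow_natCast, ← Real.rpow_mul hx.le, ← Real.rpow_natCast]; norm_num
  rw [e p hp, e q hq]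
  have hU : (u1 ^ (3 / 8 : ℝ)) * (u2 ^ (3 / 8 : ℝ)) * (u3 ^ (3 / 8 : ℝ)) * (u4 ^ (3 / 8 : ℝ))
      ≤ 6 * (p * q ^ 2) := by
    have s1 : ∀ u : ℝ, 0 < u → u ≤ 3 * p ^ 2 → u ≤ 3 * q ^ 2 →
        u ^ (3 / 8 : ℝ) ≤ (3 * p ^ 2) ^ (1 / 16 : ℝ) * (3 * q ^ 2) ^ (5 / 16 : ℝ) := by
      intro u hu hp hq
      have : u ^ (3 / 8 : ℝ) = u ^ (1 / 16 : ℝ) * u ^ (5 / 16 : ℝ) := by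
        rw [← Real.rpow_add hu]; norm_num
      rw [this]
      gcongr
    calc _ ≤ ((3 * p ^ 2) ^ (1 / 16 : ℝ) * (3 * q ^ 2) ^ (5 / 16 : ℝ)) *
          ((3 * p ^ 2) ^ (1 / 16 : ℝ) * (3 * q ^ 2) ^ (5 / 16 : ℝ)) *
          (3 * p ^ 2) ^ (3 / 8 : ℝ) * (3 * q ^ 2) ^ (3 / 8 : ℝ) := by
          gcongr
          · exact s1 u1 h1 h1P h1Q
          · exact s1 u2 h2 h2P h2Q
      _ = ((3 * p ^ 2) ^ (1 / 16 : ℝ) * (3 * p ^ 2) ^ (1 / 16 : ℝ) * (3 * p ^ 2) ^ (3 / 8 : ℝ)) *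
          ((3 * q ^ 2) ^ (5 / 16 : ℝ) * (3 * q ^ 2) ^ (5 / 16 : ℝ) * (3 * q ^ 2) ^ (3 / 8 : ℝ)) := by
          ring
      _ = √(3 * p ^ 2) * (3 * q ^ 2) := by
          rw [← Real.rpow_add (by positivity), ← Real.rpow_add (by positivity),
            ← Real.rpow_add (by positivity), ← Real.rpow_add (by positivity), Real.sqrt_eq_rpow]
          norm_num
      _ ≤ (2 * p) * (3 * q ^ 2) := by
          gcongr
          apply Real.sqrt_le_iff.2
          constructor
          · positivity
          · nlinarith [sq_nonneg p]
      _ = _ := by ring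
  have haq : a ≤ q := abs_le_of_sq_le_sq' haQ hq.le |>.2
  have hpi : (3 : ℝ) < π := Real.pi_gt_three
  calc (a / (4 * π * p ^ 3)) * (a / (4 * π * q ^ 3)) * b0
      = (a * b0) * a / (16 * π ^ 2 * (p ^ 3 * q ^ 3)) := by field_simp; ring
    _ ≤ p ^ 2 * q / (16 * π ^ 2 * (p ^ 3 * q ^ 3)) := by gcongr
    _ = 1 / (16 * π ^ 2 * (p * q ^ 2)) := by field_simp
    _ ≤ 1 / (6 * (p * q ^ 2)) := by
        gcongr
        nlinarith
    _ ≤ 1 / ((u1 ^ (3 / 8 : ℝ)) * (u2 ^ (3 / 8 : ℝ)) * (u3 ^ (3 / 8 : ℝ)) * (u4 ^ (3 / 8 : ℝ))) :=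
        one_div_le_one_div_of_le (by positivity) hU
    _ = _ := by
        rw [Real.rpow_neg h1.le, Real.rpow_neg h2.le, Real.rpow_neg h3.le, Real.rpow_neg h4.le]
        field_simp

lemma nsq (a b c : ℝ) (y : EuclideanSpace ℝ (Fin 3)) :
    ‖v3 a b c - y‖ ^ 2 = (y 0 - a) ^ 2 + (y 1 - b) ^ 2 + (y 2 - c) ^ 2 := by
  rw [EuclideanSpace.norm_sq_eq, Fin.sum_univ_three]
  simp [v3]
  ring

lemma pointwise {α : ℝ → ℝ} (hL : ∀ r ∈ II, ∀ s ∈ II, |α r - α s| ≤ |r - s|)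
    {ε : ℝ} (hε : 0 < ε) {r₀ r : ℝ} (h0 : r₀ ∈ II) (hr : r ∈ II)
    (y : EuclideanSpace ℝ (Fin 3)) (hy : y ∈ cube3) {M D : ℝ} (hM : 0 ≤ M)
    (hD : |D| ≤ M * |y 1 - α r₀|) :
    |k1eps ε (gam α r₀ - y)| * |k1eps ε (y - gam α r)| * |D| ≤
      M * (hh ε (y 0 - 0) * hh ε (y 1 - α (y 2)) * hh ε (y 2 - r₀) * hh ε (r - y 2)) := by
  have e1 : |k1eps ε (gam α r₀ - y)| = |y 0| / (4 * π *
      (((y 0) ^ 2 + (y 1 - α r₀) ^ 2 + (y 2 - r₀) ^ 2) + ε ^ 2) ^ ((3 : ℝ) / 2)) := by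
    unfold k1eps gam
    rw [nsq, abs_div, abs_of_nonneg (a := 4 * π * _) (by positivity)]
    simp [v3]
  have e2 : |k1eps ε (y - gam α r)| = |y 0| / (4 * π *
      (((y 0) ^ 2 + (y 1 - α r) ^ 2 + (y 2 - r) ^ 2) + ε ^ 2) ^ ((3 : ℝ) / 2)) := by
    unfold k1eps gam
    rw [norm_sub_rev, nsq, abs_div, abs_of_nonneg (a := 4 * π * _) (by positivity)]
    simp [v3]
  rw [e1, e2]
  have hy2 : y 2 ∈ II := hy 2
  have hb : ∀ s ∈ II, (y 1 - α (y 2)) ^ 2 ≤ 2 * (y 1 - α s) ^ 2 + 2 * (y 2 - s) ^ 2 := by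
    intro s hs
    have := sq_le_sq.2 (hL (y 2) hy2 s hs)
    nlinarith [sq_nonneg ((y 1 - α s) + (α (y 2) - α s))]
  have hb1 := hb r hr
  have hb0 := hb r₀ h0
  have he : 0 < ε ^ 2 := by positivity
  have hk := key (a := |y 0|) (b0 := |y 1 - α r₀|)
    (P := ((y 0) ^ 2 + (y 1 - α r₀) ^ 2 + (y 2 - r₀) ^ 2) + ε ^ 2)
    (Q := ((y 0) ^ 2 + (y 1 - α r) ^ 2 + (y 2 - r) ^ 2) + ε ^ 2)
    (u1 := (y 0 - 0) ^ 2 + ε ^ 2) (u2 := (y 1 - α (y 2)) ^ 2 + ε ^ 2)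
    (u3 := (y 2 - r₀) ^ 2 + ε ^ 2) (u4 := (r - y 2) ^ 2 + ε ^ 2)
    (abs_nonneg _) (abs_nonneg _) (by positivity) (by positivity) (by positivity) (by positivity)
    (by positivity) (by positivity) (by nlinarith) (by nlinarith) (by nlinarith)
    (by nlinarith) (by nlinarith) (by nlinarith)
    (by nlinarith [sq_abs (y 0), sq_abs (y 1 - α r₀), sq_nonneg (|y 0| - |y 1 - α r₀|),
      sq_nonneg (y 2 - r₀)])
    (by rw [sq_abs]; nlinarith)
  unfold hh
  calc _ ≤ |y 0| / (4 * π *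
      (((y 0) ^ 2 + (y 1 - α r₀) ^ 2 + (y 2 - r₀) ^ 2) + ε ^ 2) ^ ((3 : ℝ) / 2)) *
      (|y 0| / (4 * π *
      (((y 0) ^ 2 + (y 1 - α r) ^ 2 + (y 2 - r) ^ 2) + ε ^ 2) ^ ((3 : ℝ) / 2))) *
      (M * |y 1 - α r₀|) := by gcongr
    _ = M * (|y 0| / (4 * π *
      (((y 0) ^ 2 + (y 1 - α r₀) ^ 2 + (y 2 - r₀) ^ 2) + ε ^ 2) ^ ((3 : ℝ) / 2)) *
      (|y 0| / (4 * π *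
      (((y 0) ^ 2 + (y 1 - α r) ^ 2 + (y 2 - r) ^ 2) + ε ^ 2) ^ ((3 : ℝ) / 2))) *
      |y 1 - α r₀|) := by ring
    _ ≤ _ := by gcongr

/-- Coordinates reordered as `(y₂, y₀, y₁)`. -/
lemma coord_mp : MeasurePreserving
    (fun y : EuclideanSpace ℝ (Fin 3) => (y 2, y 0, y 1)) volume volume := by
  have h1 := PiLp.volume_preserving_ofLp (Fin 3)
  have h2 := volume_preserving_piFinSuccAbove (fun _ : Fin 3 => ℝ) 2
  have h3 := (MeasurePreserving.id (volume : Measure ℝ)).prod (volume_preserving_finTwoArrow ℝ)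
  exact (h3.comp h2).comp h1

lemma cube_int {α : ℝ → ℝ} (hα : Continuous α) (ε r₀ : ℝ) :
    ∫⁻ y in cube3, ENNReal.ofReal (hh ε (y 0 - 0)) * ENNReal.ofReal (hh ε (y 1 - α (y 2))) *
      ENNReal.ofReal (hh ε (y 2 - r₀)) ≤ KK ^ 3 := by
  have hm := hh_meas ε
  have hαm := hα.measurable
  have hc : cube3 = (fun y : EuclideanSpace ℝ (Fin 3) => (y 2, y 0, y 1)) ⁻¹'
      (II ×ˢ (II ×ˢ II)) := by
    ext y
    simp only [cube3, II, Set.mem_setOf_eq, Fin.forall_fin_succ, Set.mem_preimage, Set.mem_prod]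
    simp
    tauto
  have hI : MeasurableSet II := measurableSet_Icc
  rw [hc]
  have := coord_mp.setLIntegral_comp_preimage (s := II ×ˢ (II ×ˢ II)) (hI.prod (hI.prod hI))
    (f := fun z : ℝ × ℝ × ℝ => ENNReal.ofReal (hh ε (z.2.1 - 0)) *
      ENNReal.ofReal (hh ε (z.2.2 - α z.1)) * ENNReal.ofReal (hh ε (z.1 - r₀))) (by fun_prop)
  rw [this, Measure.volume_eq_prod, Measure.volume_eq_prod, ← Measure.prod_restrict,
    ← Measure.prod_restrict]
  refine (lintegral_prod_le _).trans ?_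
  calc _ ≤ ∫⁻ x in II, (KK * KK) * ENNReal.ofReal (hh ε (x - r₀)) := by
        apply lintegral_mono
        intro x
        dsimp only
        rw [lintegral_mul_const _ (by fun_prop)]
        gcongr
        refine (lintegral_prod_le _).trans ?_
        calc _ ≤ ∫⁻ a in II, ENNReal.ofReal (hh ε (a - 0)) * KK := by
              apply lintegral_mono
              intro a
              dsimp only
              rw [lintegral_const_mul _ (by fun_prop)]
              gcongr
              exact hh_int ε _
          _ ≤ _ := by
              rw [lintegral_mul_const _ (by fun_prop)]
              gcongr
              exact hh_int ε 0
    _ ≤ KK ^ 3 := by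
        rw [lintegral_const_mul _ (by fun_prop), pow_succ, pow_two]
        gcongr
        exact hh_int ε r₀

/-- Error estimate for freezing the background vorticity gradient at the filament point:
with `v₂(y) := −Γ ∫ k̄₁^ε(y − γ(r)) dr`, one has
`|∫_{[−1/2,1/2]³} k̄₁^ε(γ(r₀) − y) v₂(y) (w′(y₂) − w′(α(r₀))) dy| ≤ C Γ ‖w″‖_∞`,
with `C` universal, uniformly in `ε ∈ (0,1]`. -/
theorem frozen_gradient_error_estimate :
    ∃ C : ℝ, 0 < C ∧
      ∀ (α : ℝ → ℝ), ContDiff ℝ 1 α →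
      (∀ r ∈ Set.Icc (-(1/2) : ℝ) (1/2), |deriv α r| ≤ 1) →
      ∀ ε : ℝ, ε ∈ Set.Ioc (0 : ℝ) 1 →
      ∀ Γ : ℝ, 0 < Γ →
      ∀ r₀ ∈ Set.Icc (-(1/2) : ℝ) (1/2),
      ∀ w : ℝ → ℝ, ContDiff ℝ 2 w →
      ∀ M : ℝ, (∀ s : ℝ, |deriv (deriv w) s| ≤ M) →
        |∫ y in cube3,
            k1eps ε (gam α r₀ - y)
              * (-Γ * ∫ r in Set.Icc (-(1/2) : ℝ) (1/2), k1eps ε (y - gam α r))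
              * (deriv w (y 1) - deriv w (α r₀))|
          ≤ C * Γ * M := by
  refine ⟨(KK ^ 4).toReal + 1, by positivity, ?_⟩
  intro α hα hα' ε hε Γ hΓ r₀ hr₀ w hw M hM
  have hM0 : 0 ≤ M := (abs_nonneg _).trans (hM 0)
  have hL : ∀ r ∈ II, ∀ s ∈ II, |α r - α s| ≤ |r - s| := by
    intro r hr s hs
    have := Convex.norm_image_sub_le_of_norm_deriv_le (f := α) (C := 1) (s := II) (x := s) (y := r)
      (fun x _ => (hα.differentiable (by norm_num)) x) hα' (convex_Icc _ _) hs hr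
    simpa using this
  have hw1 : Differentiable ℝ (deriv w) := by
    have h2 : ContDiff ℝ (1 + 1) w := by simpa [one_add_one_eq_two] using hw
    exact (contDiff_succ_iff_deriv.1 h2).2.2.differentiable (by norm_num)
  have hD : ∀ a b : ℝ, |deriv w a - deriv w b| ≤ M * |a - b| := by
    intro a b
    exact Convex.norm_image_sub_le_of_norm_deriv_le (f := deriv w) (C := M) (s := Set.univ)
      (fun x _ => hw1 x) (fun x _ => hM x) convex_univ (Set.mem_univ _) (Set.mem_univ _)
  have hm := hh_meas ε
  have hcm : MeasurableSet cube3 := by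
    have : cube3 = ⋂ i, (fun y : EuclideanSpace ℝ (Fin 3) => y i) ⁻¹'
        (Set.Icc (-(1/2) : ℝ) (1/2)) := by
      ext y; simp [cube3]
    rw [this]
    exact MeasurableSet.iInter fun i => (by fun_prop : Measurable
      (fun y : EuclideanSpace ℝ (Fin 3) => y i)) measurableSet_Icc
  have main : ‖∫ y in cube3,
            k1eps ε (gam α r₀ - y)
              * (-Γ * ∫ r in Set.Icc (-(1/2) : ℝ) (1/2), k1eps ε (y - gam α r))
              * (deriv w (y 1) - deriv w (α r₀))‖ₑ ≤ ENNReal.ofReal (Γ * M) * KK ^ 4 := by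
    refine (enorm_integral_le_lintegral_enorm _).trans ?_
    calc _ ≤ ∫⁻ y in cube3, (ENNReal.ofReal (Γ * M) * KK) * (ENNReal.ofReal (hh ε (y 0 - 0)) *
          ENNReal.ofReal (hh ε (y 1 - α (y 2))) * ENNReal.ofReal (hh ε (y 2 - r₀))) := by
          apply setLIntegral_mono' hcm
          intro y hy
          rw [enorm_mul, enorm_mul, enorm_mul]
          set A := ‖k1eps ε (gam α r₀ - y)‖ₑ with hA
          set B := ‖deriv w (y 1) - deriv w (α r₀)‖ₑ with hB
          set H := ENNReal.ofReal (hh ε (y 0 - 0)) *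
            ENNReal.ofReal (hh ε (y 1 - α (y 2))) * ENNReal.ofReal (hh ε (y 2 - r₀)) with hH
          have hG : ‖-Γ‖ₑ = ENNReal.ofReal Γ := by
            rw [enorm_neg, Real.enorm_of_nonneg hΓ.le]
          rw [hG]
          have hAB : A * B ≠ ⊤ := ENNReal.mul_ne_top enorm_ne_top enorm_ne_top
          calc A * (ENNReal.ofReal Γ * ‖∫ r in Set.Icc (-(1/2) : ℝ) (1/2),
                k1eps ε (y - gam α r)‖ₑ) * B
              = ENNReal.ofReal Γ * (A * B * ‖∫ r in Set.Icc (-(1/2) : ℝ) (1/2),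
                k1eps ε (y - gam α r)‖ₑ) := by ring
            _ ≤ ENNReal.ofReal Γ * (A * B * ∫⁻ r in II, ‖k1eps ε (y - gam α r)‖ₑ) := by
                gcongr
                exact enorm_integral_le_lintegral_enorm _
            _ = ENNReal.ofReal Γ * (∫⁻ r in II, A * B * ‖k1eps ε (y - gam α r)‖ₑ) := by
                rw [lintegral_const_mul' _ _ hAB]
            _ ≤ ENNReal.ofReal Γ * (∫⁻ r in II, ENNReal.ofReal M * H *
                  ENNReal.ofReal (hh ε (r - y 2))) := by
                gcongr ENNReal.ofReal Γ * ?_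
                apply setLIntegral_mono' measurableSet_Icc
                intro r hr
                have hp := pointwise hL hε.1 hr₀ hr y hy hM0 (hD (y 1) (α r₀))
                rw [hA, hB, hH, ← ofReal_norm, ← ofReal_norm, ← ofReal_norm,
                  ← ENNReal.ofReal_mul (by positivity), ← ENNReal.ofReal_mul (by positivity),
                  ← ENNReal.ofReal_mul (hh_nonneg _ _),
                  ← ENNReal.ofReal_mul (mul_nonneg (hh_nonneg _ _) (hh_nonneg _ _)),
                  ← ENNReal.ofReal_mul hM0,
                  ← ENNReal.ofReal_mul (mul_nonneg hM0 (mul_nonneg (mul_nonneg (hh_nonneg _ _)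
                    (hh_nonneg _ _)) (hh_nonneg _ _)))]
                apply ENNReal.ofReal_le_ofReal
                simp only [Real.norm_eq_abs]
                linarith
            _ ≤ ENNReal.ofReal Γ * (ENNReal.ofReal M * H * KK) := by
                rw [lintegral_const_mul _ (by fun_prop)]
                gcongr
                exact hh_int ε _
            _ = _ := by
                rw [ENNReal.ofReal_mul hΓ.le]; ring
      _ ≤ (ENNReal.ofReal (Γ * M) * KK) * KK ^ 3 := by
          rw [lintegral_const_mul' _ _ (ENNReal.mul_ne_top (by simp) KK_lt_top.ne)]
          gcongr
          exact cube_int hα.continuous ε r₀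
      _ = _ := by ring
  have hK : KK ^ 4 ≠ ⊤ := ENNReal.pow_ne_top KK_lt_top.ne
  have h2 := ENNReal.toReal_mono (ENNReal.mul_ne_top (by simp) hK) main
  rw [toReal_enorm, ENNReal.toReal_mul, ENNReal.toReal_ofReal (by positivity),
    Real.norm_eq_abs] at h2
  refine h2.trans ?_
  have : 0 ≤ Γ * M := by positivity
  nlinarith
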